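/- Let X be a measurable space and V a vector space over ℚ of countable dimension, and let x ↦ W_x be a field of ℚ-linear subspaces of V such that for every v ∈ V the set {x ∈ X : v ∈ W_x} is measurable (equivalently, for every measurable map s : X → V the set {x ∈ X : s(x) ∈ W_x} is measurable). Then there exists a field x ↦ p_x of ℚ-linear idempotent operators on V with range p_x = W_x for every x ∈ X (so each p_x is a projection of V onto W_x), which is measurable in the sense that for every v ∈ V the map x ↦ p_x(v) is measurable (equivalently, for every measurable s : X → V the map x ↦ p_x(s(x)) is measurable). -/

import Mathlib

open Cardinal

section GreedyComplement

variable {K V : Type*} [Field K] [AddCommGroup V] [Module K V]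

/-- The indices `n` such that `e n` is not in the span of `W` and the earlier vectors. -/
def greedyIndices (e : ℕ → V) (W : Submodule K V) : Set ℕ :=
  {n | e n ∉ W ⊔ Submodule.span K (e '' Set.Iio n)}

/-- The span of the vectors of `e` selected by `greedyIndices`. -/
def greedyComplement (e : ℕ → V) (W : Submodule K V) : Submodule K V :=
  Submodule.span K (e '' greedyIndices e W)

lemma disjoint_greedyComplement (e : ℕ → V) (W : Submodule K V) :
    Disjoint W (greedyComplement e W) := by
  rw [Submodule.disjoint_def]
  intro v hv hC
  obtain ⟨c, hc, rfl⟩ := (Finsupp.mem_span_image_iff_linearCombination K).1 hC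
  by_contra h
  have hs : c.support.Nonempty := by
    rw [Finsupp.support_nonempty_iff]
    rintro rfl
    simp at h
  set m := c.support.max' hs
  have hmem : m ∈ c.support := c.support.max'_mem hs
  refine hc hmem ?_
  have hsum : Finsupp.linearCombination K e c
      = c m • e m + ∑ i ∈ c.support.erase m, c i • e i := by
    rw [Finsupp.linearCombination_apply, Finsupp.sum,
      Finset.add_sum_erase _ (fun i => c i • e i) hmem]
  have hlow : ∑ i ∈ c.support.erase m, c i • e i ∈ Submodule.span K (e '' Set.Iio m) := by
    refine Submodule.sum_mem _ fun i hi => Submodule.smul_mem _ _ (Submodule.subset_span ?_)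
    exact ⟨i, Finset.lt_max'_of_mem_erase_max' _ hs hi, rfl⟩
  have hcm : c m ≠ 0 := Finsupp.mem_support_iff.1 hmem
  rw [← Submodule.smul_mem_iff _ hcm, eq_sub_of_add_eq hsum.symm]
  exact Submodule.sub_mem _ (Submodule.mem_sup_left hv) (Submodule.mem_sup_right hlow)

lemma codisjoint_greedyComplement {e : ℕ → V} (he : Submodule.span K (Set.range e) = ⊤)
    (W : Submodule K V) : Codisjoint W (greedyComplement e W) := by
  rw [codisjoint_iff, eq_top_iff, ← he, Submodule.span_le]
  rintro _ ⟨n, rfl⟩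
  induction n using Nat.strong_induction_on with
  | _ n ih =>
    by_cases hn : n ∈ greedyIndices e W
    · exact Submodule.mem_sup_right (Submodule.subset_span ⟨n, hn, rfl⟩)
    · have hle : W ⊔ Submodule.span K (e '' Set.Iio n) ≤ W ⊔ greedyComplement e W := by
        refine sup_le le_sup_left (Submodule.span_le.2 ?_)
        rintro _ ⟨i, hi, rfl⟩
        exact ih i hi
      exact hle (not_not.1 hn)

lemma isCompl_greedyComplement {e : ℕ → V} (he : Submodule.span K (Set.range e) = ⊤)
    (W : Submodule K V) : IsCompl W (greedyComplement e W) :=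
  ⟨disjoint_greedyComplement e W, codisjoint_greedyComplement he W⟩

lemma mem_span_image_iff_exists_finset (e : ℕ → V) (s : Set ℕ) (v : V) :
    v ∈ Submodule.span K (e '' s) ↔
      ∃ F : Finset ℕ, v ∈ Submodule.span K (e '' (F : Set ℕ)) ∧ ∀ n ∈ F, n ∈ s := by
  constructor
  · intro h
    obtain ⟨c, hc, rfl⟩ := (Finsupp.mem_span_image_iff_linearCombination K).1 h
    exact ⟨c.support, (Finsupp.mem_span_image_iff_linearCombination K).2
      ⟨c, (Finsupp.mem_supported K c).2 subset_rfl, rfl⟩, hc⟩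
  · rintro ⟨F, hv, hF⟩
    exact Submodule.span_mono (Set.image_mono hF) hv

variable {X : Type*} [MeasurableSpace X] [Countable V] {W : X → Submodule K V}

lemma measurableSet_mem_greedyIndices (hW : ∀ v : V, MeasurableSet {x | v ∈ W x})
    (e : ℕ → V) (n : ℕ) : MeasurableSet {x | n ∈ greedyIndices e (W x)} := by
  have h : {x | n ∈ greedyIndices e (W x)} =
      (⋃ u ∈ Submodule.span K (e '' Set.Iio n), {x | e n - u ∈ W x})ᶜ := by
    ext x
    simp only [greedyIndices, Set.mem_ofPred_eq, Set.mem_compl_iff, Set.mem_iUnion, exists_prop,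
      not_iff_not]
    constructor
    · intro hx
      obtain ⟨w, hw, u, hu, h⟩ := Submodule.mem_sup.1 hx
      exact ⟨u, hu, by rwa [← h, add_sub_cancel_right]⟩
    · rintro ⟨u, hu, h⟩
      exact Submodule.mem_sup.2 ⟨_, h, u, hu, sub_add_cancel _ _⟩
  rw [h]
  exact (MeasurableSet.biUnion (Set.to_countable _) fun u _ => hW _).compl

lemma measurableSet_mem_greedyComplement (hW : ∀ v : V, MeasurableSet {x | v ∈ W x})
    (e : ℕ → V) (v : V) : MeasurableSet {x | v ∈ greedyComplement e (W x)} := by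
  have h : {x | v ∈ greedyComplement e (W x)} =
      ⋃ F : Finset ℕ, {_x | v ∈ Submodule.span K (e '' (F : Set ℕ))} ∩
        ⋂ n ∈ F, {x | n ∈ greedyIndices e (W x)} := by
    ext x
    simpa [greedyComplement] using mem_span_image_iff_exists_finset e (greedyIndices e (W x)) v
  rw [h]
  exact MeasurableSet.iUnion fun F => (MeasurableSet.const _).inter
    (F.measurableSet_biInter fun n _ => measurableSet_mem_greedyIndices hW e n)

end GreedyComplement

lemma projection_apply_eq_iff {R E : Type*} [Ring R] [AddCommGroup E] [Module R E]
    {p q : Submodule R E} (h : IsCompl p q) {v w : E} :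
    p.projection q h v = w ↔ w ∈ p ∧ v - w ∈ q := by
  have key (hw : w ∈ p) : p.projection q h v = w ↔ v - w ∈ q := by
    rw [← Submodule.projection_apply_eq_zero_iff h, map_sub,
      Submodule.projection_apply_of_mem_left h hw, sub_eq_zero]
  refine ⟨fun hv => ?_, fun hw => (key hw.1).2 hw.2⟩
  have hw : w ∈ p := hv ▸ Submodule.projection_apply_mem h v
  exact ⟨hw, (key hw).1 hv⟩

lemma countable_of_rank_le_aleph0 {K V : Type*} [Field K] [Countable K] [AddCommGroup V]
    [Module K V] (h : Module.rank K V ≤ ℵ₀) : Countable V := by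
  let b := Module.Basis.ofVectorSpace K V
  have : Countable (Module.Basis.ofVectorSpaceIndex K V) := by
    rw [← Cardinal.mk_le_aleph0_iff, b.mk_eq_rank'']
    exact h
  exact b.repr.toEquiv.countable_iff.2 inferInstance

/-- **Lemma 5 (lproj).** Let `X` be a measurable space and `V` a vector space
over `ℚ` of countable dimension, equipped with the discrete σ-algebra (every
subset measurable). Given a field `x ↦ W x` of `ℚ`-linear subspaces of `V`
such that `{x | v ∈ W x}` is measurable for every `v`, there exists a
measurable field `x ↦ p x` of `ℚ`-linear idempotents on `V` with
`range (p x) = W x` for every `x`. -/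
theorem stmt_0 {X V : Type*} [MeasurableSpace X]
    [AddCommGroup V] [Module ℚ V] [MeasurableSpace V]
    (hdisc : ∀ s : Set V, MeasurableSet s)
    (hdim : Module.rank ℚ V ≤ ℵ₀)
    (W : X → Submodule ℚ V)
    (hW : ∀ v : V, MeasurableSet {x : X | v ∈ W x}) :
    ∃ p : X → (V →ₗ[ℚ] V),
      (∀ x, (p x) ∘ₗ (p x) = p x) ∧
      (∀ x, LinearMap.range (p x) = W x) ∧
      (∀ v : V, Measurable fun x => p x v) := by
  have : Countable V := countable_of_rank_le_aleph0 hdim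
  obtain ⟨e, he⟩ := exists_surjective_nat V
  have hspan : Submodule.span ℚ (Set.range e) = ⊤ := by
    rw [he.range_eq, Submodule.span_univ]
  have hc : ∀ x, IsCompl (W x) (greedyComplement e (W x)) :=
    fun x => isCompl_greedyComplement hspan (W x)
  refine ⟨fun x => (W x).projection _ (hc x), fun x => LinearMap.ext fun v => ?_,
    fun x => Submodule.range_projection (hc x), fun v => ?_⟩
  · exact Submodule.projection_apply_of_mem_left _ (Submodule.projection_apply_mem _ _)
  have hfib (w : V) : MeasurableSet {x | (W x).projection _ (hc x) v = w} := by
    simp only [projection_apply_eq_iff]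
    exact (hW w).inter (measurableSet_mem_greedyComplement hW e _)
  intro s _
  have h : (fun x => (W x).projection _ (hc x) v) ⁻¹' s =
      ⋃ w ∈ s, {x | (W x).projection _ (hc x) v = w} := by
    ext x
    simp
  rw [h]
  exact MeasurableSet.biUnion (Set.to_countable _) fun w _ => hfib w
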